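/- arXiv:1506.01605 — 2 statements merged into one kernel-verified Lean document; each statement's English description precedes it below -/
import Mathlib

section
/- Let Ω ⊆ ℝ² be open, let g : Ω → ℝ³ be a smooth immersion with unit normal N := (g_x × g_y)/‖g_x × g_y‖, suppose the mean curvature of g with respect to N is a nonzero real constant H₁, let K₁ be the Gauss curvature of g with respect to N, and define f := g + (1/(2H₁))·N. Then at every point p ∈ Ω with K₁(p) ≠ 0, the map f is an immersion at p, N is a unit normal field for f, and the Gauss curvature of f with respect to N at p equals 4H₁². -/
noncomputable section

open Real

/-- Euclidean dot product on `ℝ³`. -/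
def dot3 (u v : Fin 3 → ℝ) : ℝ := u 0 * v 0 + u 1 * v 1 + u 2 * v 2

/-- Cross product on `ℝ³`. -/
def cross3 (u v : Fin 3 → ℝ) : Fin 3 → ℝ :=
  ![u 1 * v 2 - u 2 * v 1, u 2 * v 0 - u 0 * v 2, u 0 * v 1 - u 1 * v 0]

/-- Euclidean norm on `ℝ³`. -/
def norm3 (u : Fin 3 → ℝ) : ℝ := Real.sqrt (dot3 u u)

/-- Partial derivative in the first (x) coordinate direction. -/
def px (f : ℝ × ℝ → Fin 3 → ℝ) (p : ℝ × ℝ) : Fin 3 → ℝ := fderiv ℝ f p (1, 0)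

/-- Partial derivative in the second (y) coordinate direction. -/
def py (f : ℝ × ℝ → Fin 3 → ℝ) (p : ℝ × ℝ) : Fin 3 → ℝ := fderiv ℝ f p (0, 1)

/-- Gauss curvature of `g` with respect to the unit normal field `ν`:
`K = (l·n − m²)/(E·G − F²)`. -/
def GaussK (g ν : ℝ × ℝ → Fin 3 → ℝ) (p : ℝ × ℝ) : ℝ :=
  (dot3 (px (px g) p) (ν p) * dot3 (py (py g) p) (ν p) - dot3 (py (px g) p) (ν p) ^ 2) /
    (dot3 (px g p) (px g p) * dot3 (py g p) (py g p) - dot3 (px g p) (py g p) ^ 2)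

/-- Mean curvature of `g` with respect to the unit normal field `ν`:
`H = (E·n − 2F·m + G·l)/(2(E·G − F²))`. -/
def MeanH (g ν : ℝ × ℝ → Fin 3 → ℝ) (p : ℝ × ℝ) : ℝ :=
  (dot3 (px g p) (px g p) * dot3 (py (py g) p) (ν p)
      - 2 * dot3 (px g p) (py g p) * dot3 (py (px g) p) (ν p)
      + dot3 (py g p) (py g p) * dot3 (px (px g) p) (ν p)) /
    (2 * (dot3 (px g p) (px g p) * dot3 (py g p) (py g p) - dot3 (px g p) (py g p) ^ 2))

open scoped ContDiff Topology

theorem ContDiffAt.fderiv_apply_const {h : ℝ × ℝ → Fin 3 → ℝ} {p : ℝ × ℝ}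
    (hh : ContDiffAt ℝ ∞ h p) (e : ℝ × ℝ) : ContDiffAt ℝ ∞ (fun q => fderiv ℝ h q e) p :=
  (hh.fderiv_right (m := ∞) (by simp)).clm_apply contDiffAt_const

theorem fderiv_fderiv_comm {h : ℝ × ℝ → Fin 3 → ℝ} {p : ℝ × ℝ}
    (hh : ContDiffAt ℝ ∞ h p) (e e₂ : ℝ × ℝ) :
    fderiv ℝ (fun q => fderiv ℝ h q e) p e₂ = fderiv ℝ (fun q => fderiv ℝ h q e₂) p e := by
  have hd : DifferentiableAt ℝ (fderiv ℝ h) p :=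
    (hh.fderiv_right (m := ∞) (by simp)).differentiableAt (by simp)
  have key : ∀ e e₂ : ℝ × ℝ,
      fderiv ℝ (fun q => fderiv ℝ h q e) p e₂ = fderiv ℝ (fderiv ℝ h) p e₂ e := by
    intro e e₂
    rw [fderiv_clm_apply hd (differentiableAt_const e)]
    simp
  rw [key, key]
  exact (hh.isSymmSndFDerivAt (by simp; exact WithTop.coe_le_coe.2 le_top)) e₂ e

/-- If `⟨u, v⟩` is locally constant then the product rule gives `⟨∂u, v⟩ + ⟨u, ∂v⟩ = 0`. -/
theorem dot3_fderiv_of_eventually_const {u v : ℝ × ℝ → Fin 3 → ℝ} {p : ℝ × ℝ} {c : ℝ}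
    (hu : ContDiffAt ℝ ∞ u p) (hv : ContDiffAt ℝ ∞ v p)
    (h : ∀ᶠ q in 𝓝 p, dot3 (u q) (v q) = c) (e : ℝ × ℝ) :
    dot3 (fderiv ℝ u p e) (v p) + dot3 (u p) (fderiv ℝ v p e) = 0 := by
  have hu' := hasFDerivAt_pi'.1 (hu.differentiableAt (by simp)).hasFDerivAt
  have hv' := hasFDerivAt_pi'.1 (hv.differentiableAt (by simp)).hasFDerivAt
  have h1 := (((hu' 0).mul (hv' 0)).add ((hu' 1).mul (hv' 1))).add ((hu' 2).mul (hv' 2))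
  have h2 : HasFDerivAt (fun q => dot3 (u q) (v q)) (0 : ℝ × ℝ →L[ℝ] ℝ) p :=
    (hasFDerivAt_const c p).congr_of_eventuallyEq h
  have h3 := congrArg (fun L : ℝ × ℝ →L[ℝ] ℝ => L e) (h1.unique h2)
  simp at h3
  simp only [dot3]
  linarith

theorem ContDiffAt.cross3 {u v : ℝ × ℝ → Fin 3 → ℝ} {p : ℝ × ℝ}
    (hu : ContDiffAt ℝ ∞ u p) (hv : ContDiffAt ℝ ∞ v p) :
    ContDiffAt ℝ ∞ (fun q => _root_.cross3 (u q) (v q)) p := by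
  have hu' := contDiffAt_pi.1 hu
  have hv' := contDiffAt_pi.1 hv
  refine contDiffAt_pi.2 fun i => ?_
  fin_cases i
  · exact ((hu' 1).mul (hv' 2)).sub ((hu' 2).mul (hv' 1))
  · exact ((hu' 2).mul (hv' 0)).sub ((hu' 0).mul (hv' 2))
  · exact ((hu' 0).mul (hv' 1)).sub ((hu' 1).mul (hv' 0))

theorem ContDiffAt.dot3 {u v : ℝ × ℝ → Fin 3 → ℝ} {p : ℝ × ℝ}
    (hu : ContDiffAt ℝ ∞ u p) (hv : ContDiffAt ℝ ∞ v p) :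
    ContDiffAt ℝ ∞ (fun q => _root_.dot3 (u q) (v q)) p := by
  have hu' := contDiffAt_pi.1 hu
  have hv' := contDiffAt_pi.1 hv
  exact (((hu' 0).mul (hv' 0)).add ((hu' 1).mul (hv' 1))).add ((hu' 2).mul (hv' 2))

theorem dot3_self_pos {u : Fin 3 → ℝ} (hu : u ≠ 0) : 0 < dot3 u u := by
  have h : 0 ≤ dot3 u u := by
    simp only [dot3]; nlinarith [sq_nonneg (u 0), sq_nonneg (u 1), sq_nonneg (u 2)]
  refine lt_of_le_of_ne h fun h0 => hu ?_
  simp only [dot3] at h0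
  funext i
  have : u i * u i = 0 := by
    fin_cases i <;> simp <;>
      nlinarith [mul_self_nonneg (u 0), mul_self_nonneg (u 1), mul_self_nonneg (u 2)]
  simpa using this

theorem dot3_comm (u v : Fin 3 → ℝ) : dot3 u v = dot3 v u := by
  simp only [dot3]; ring

theorem dot3_add_smul_left (u v w : Fin 3 → ℝ) (t : ℝ) :
    dot3 (u + t • v) w = dot3 u w + t * dot3 v w := by
  simp [dot3]; ring

theorem dot3_smul_right (u v : Fin 3 → ℝ) (t : ℝ) : dot3 u (t • v) = t * dot3 u v := by
  simp [dot3]; ring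

theorem dot3_cross3_cross3 (u v w z : Fin 3 → ℝ) :
    dot3 (cross3 u v) (cross3 w z) = dot3 u w * dot3 v z - dot3 u z * dot3 v w := by
  simp [dot3, cross3]; ring

/-- Expansion of a vector orthogonal to `a × b` in terms of `a` and `b`. -/
theorem gram_smul_of_orthogonal_cross3 {a b u : Fin 3 → ℝ} (h : dot3 u (cross3 a b) = 0) :
    (dot3 a a * dot3 b b - dot3 a b ^ 2) • u =
      (dot3 u a * dot3 b b - dot3 u b * dot3 a b) • a +
        (dot3 u b * dot3 a a - dot3 u a * dot3 a b) • b := by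
  simp [dot3, cross3] at h
  funext i
  fin_cases i <;> simp [dot3]
  · linear_combination (a 1 * b 2 - a 2 * b 1) * h
  · linear_combination (a 2 * b 0 - a 0 * b 2) * h
  · linear_combination (a 0 * b 1 - a 1 * b 0) * h

theorem cross3_comb (a b : Fin 3 → ℝ) (α β γ δ : ℝ) :
    cross3 (α • a + β • b) (γ • a + δ • b) = (α * δ - β * γ) • cross3 a b := by
  funext i
  fin_cases i <;> simp [cross3] <;> ring

/-- Pointwise linear algebra behind the parallel surface theorem: `a, b` are the tangent vectors,
`u, v` the derivatives of the unit normal. -/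
theorem parallel_surface_algebra {a b u v : Fin 3 → ℝ} {H K : ℝ} (hH : H ≠ 0)
    (hab : cross3 a b ≠ 0) (hu : dot3 u (cross3 a b) = 0) (hv : dot3 v (cross3 a b) = 0)
    (hsymm : dot3 v a = dot3 u b)
    (hmean : (dot3 a a * -dot3 v b - 2 * dot3 a b * -dot3 v a + dot3 b b * -dot3 u a) /
      (2 * (dot3 a a * dot3 b b - dot3 a b ^ 2)) = H)
    (hgauss : (-dot3 u a * -dot3 v b - (-dot3 v a) ^ 2) /
      (dot3 a a * dot3 b b - dot3 a b ^ 2) = K) :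
    cross3 u v = K • cross3 a b ∧
      cross3 (a + (1 / (2 * H)) • u) (b + (1 / (2 * H)) • v) =
        ((1 / (2 * H)) ^ 2 * K) • cross3 a b := by
  have hD : dot3 a a * dot3 b b - dot3 a b ^ 2 ≠ 0 := by
    have := (dot3_self_pos hab).ne'
    rw [dot3_cross3_cross3, dot3_comm b a] at this
    rwa [sq]
  have hu1 := gram_smul_of_orthogonal_cross3 hu
  have hv1 := gram_smul_of_orthogonal_cross3 hv
  generalize dot3 a a = E at *
  generalize dot3 a b = F at *
  generalize dot3 b b = G at *
  generalize dot3 u a = l at *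
  rw [hsymm] at hv1 hmean hgauss
  generalize dot3 u b = m at *
  generalize dot3 v b = n at *
  set D := E * G - F ^ 2 with hDdef
  have hu2 : u = ((l * G - m * F) / D) • a + ((m * E - l * F) / D) • b := by
    rw [← inv_smul_smul₀ hD u, hu1, smul_add, smul_smul, smul_smul]
    congr 2 <;> ring
  have hv2 : v = ((m * G - n * F) / D) • a + ((n * E - m * F) / D) • b := by
    rw [← inv_smul_smul₀ hD v, hv1, smul_add, smul_smul, smul_smul]
    congr 2 <;> ring
  have hdet : (l * G - m * F) / D * ((n * E - m * F) / D) -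
      (m * E - l * F) / D * ((m * G - n * F) / D) = K := by
    rw [← hgauss]; field_simp; rw [hDdef]; ring
  have htr : (l * G - m * F) / D + (n * E - m * F) / D = -2 * H := by
    rw [← hmean]; field_simp; ring
  generalize (l * G - m * F) / D = α at *
  generalize (m * E - l * F) / D = β at *
  generalize (m * G - n * F) / D = γ at *
  generalize (n * E - m * F) / D = δ at *
  refine ⟨by rw [hu2, hv2, cross3_comb, hdet], ?_⟩
  have e1 : a + (1 / (2 * H)) • u = (1 + 1 / (2 * H) * α) • a + (1 / (2 * H) * β) • b := by
    rw [hu2]; module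
  have e2 : b + (1 / (2 * H)) • v = (1 / (2 * H) * γ) • a + (1 + 1 / (2 * H) * δ) • b := by
    rw [hv2]; module
  rw [e1, e2, cross3_comb]
  congr 1
  have ht : 1 / (2 * H) * (2 * H) = 1 := by field_simp
  linear_combination (1 / (2 * H)) ^ 2 * hdet + 1 / (2 * H) * htr - ht

/-- the parallel surface `f = g + (1/(2H₁))·N` of a CMC `H₁` surface has
constant Gauss curvature `4H₁²` wherever `K₁ ≠ 0`. -/
theorem stmt1 (Ω : Set (ℝ × ℝ)) (hΩ : IsOpen Ω)
    (g N f : ℝ × ℝ → Fin 3 → ℝ)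
    (hg : ContDiffOn ℝ (⊤ : ℕ∞) g Ω)
    (himm : ∀ p ∈ Ω, cross3 (px g p) (py g p) ≠ 0)
    (hN : ∀ p ∈ Ω, N p = (norm3 (cross3 (px g p) (py g p)))⁻¹ • cross3 (px g p) (py g p))
    (H₁ : ℝ) (hH₁ : H₁ ≠ 0)
    (hmean : ∀ p ∈ Ω, MeanH g N p = H₁)
    (hf : ∀ p, f p = g p + (1 / (2 * H₁)) • N p) :
    ∀ p ∈ Ω, GaussK g N p ≠ 0 →
      cross3 (px f p) (py f p) ≠ 0 ∧
      (norm3 (N p) = 1 ∧ dot3 (px f p) (N p) = 0 ∧ dot3 (py f p) (N p) = 0) ∧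
      GaussK f N p = 4 * H₁ ^ 2 := by
  have hgs : ∀ q ∈ Ω, ContDiffAt ℝ ∞ g q := fun q hq => hg.contDiffAt (hΩ.mem_nhds hq)
  have hgx : ∀ q ∈ Ω, ContDiffAt ℝ ∞ (px g) q := fun q hq => (hgs q hq).fderiv_apply_const _
  have hgy : ∀ q ∈ Ω, ContDiffAt ℝ ∞ (py g) q := fun q hq => (hgs q hq).fderiv_apply_const _
  have hNs : ∀ q ∈ Ω, ContDiffAt ℝ ∞ N q := by
    intro q hq
    have hc := (hgx q hq).cross3 (hgy q hq)
    have hpos := dot3_self_pos (himm q hq)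
    have hn := (hc.dot3 hc).sqrt hpos.ne'
    refine ((hn.inv (Real.sqrt_pos.2 hpos).ne').smul hc).congr_of_eventuallyEq ?_
    filter_upwards [hΩ.mem_nhds hq] with r hr
    exact hN r hr
  have hfs : ∀ q ∈ Ω, ContDiffAt ℝ ∞ f q := by
    intro q hq
    rw [funext hf]
    exact (hgs q hq).add ((hNs q hq).const_smul (1 / (2 * H₁)))
  have hfd : ∀ q ∈ Ω, ∀ e, fderiv ℝ f q e = fderiv ℝ g q e + (1 / (2 * H₁)) • fderiv ℝ N q e := by
    intro q hq e
    have h1 := ((hgs q hq).differentiableAt (by simp)).hasFDerivAt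
    have h2 := ((hNs q hq).differentiableAt (by simp)).hasFDerivAt
    have h3 : HasFDerivAt f (fderiv ℝ g q + (1 / (2 * H₁)) • fderiv ℝ N q) q := by
      rw [funext hf]
      exact h1.add (h2.const_smul (1 / (2 * H₁)))
    rw [h3.fderiv]
    rfl
  have hNN : ∀ q ∈ Ω, dot3 (N q) (N q) = 1 := by
    intro q hq
    have hpos := dot3_self_pos (himm q hq)
    rw [hN q hq, dot3_smul_right, dot3_comm, dot3_smul_right, norm3, ← mul_assoc, ← mul_inv,
      Real.mul_self_sqrt hpos.le, inv_mul_cancel₀ hpos.ne']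
  have hgxN : ∀ q ∈ Ω, dot3 (px g q) (N q) = 0 := by
    intro q hq
    rw [hN q hq, dot3_smul_right]
    simp [dot3, cross3]; right; ring
  have hgyN : ∀ q ∈ Ω, dot3 (py g q) (N q) = 0 := by
    intro q hq
    rw [hN q hq, dot3_smul_right]
    simp [dot3, cross3]; right; ring
  have ev : ∀ {P : ℝ × ℝ → Prop} {q}, q ∈ Ω → (∀ r ∈ Ω, P r) → ∀ᶠ r in 𝓝 q, P r :=
    fun hq h => Filter.mem_of_superset (hΩ.mem_nhds hq) h
  have hdN : ∀ q ∈ Ω, ∀ e, dot3 (fderiv ℝ N q e) (N q) = 0 := by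
    intro q hq e
    have := dot3_fderiv_of_eventually_const (hNs q hq) (hNs q hq) (ev hq hNN) e
    rw [dot3_comm (N q)] at this
    linarith
  have hfxN : ∀ q ∈ Ω, dot3 (px f q) (N q) = 0 := by
    intro q hq
    rw [px, hfd q hq, dot3_add_smul_left, hdN q hq, mul_zero, add_zero]
    exact hgxN q hq
  have hfyN : ∀ q ∈ Ω, dot3 (py f q) (N q) = 0 := by
    intro q hq
    rw [py, hfd q hq, dot3_add_smul_left, hdN q hq, mul_zero, add_zero]
    exact hgyN q hq
  intro p hp hK
  have hfx : ContDiffAt ℝ ∞ (px f) p := (hfs p hp).fderiv_apply_const _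
  have hfy : ContDiffAt ℝ ∞ (py f) p := (hfs p hp).fderiv_apply_const _
  have second : ∀ {w : ℝ × ℝ → Fin 3 → ℝ}, ContDiffAt ℝ ∞ w p →
      (∀ q ∈ Ω, dot3 (w q) (N q) = 0) → ∀ e,
      dot3 (fderiv ℝ w p e) (N p) = -dot3 (fderiv ℝ N p e) (w p) := by
    intro w hw h e
    have := dot3_fderiv_of_eventually_const hw (hNs p hp) (ev hp h) e
    rw [dot3_comm (w p)] at this
    linarith
  have gxx : dot3 (px (px g) p) (N p) = -dot3 (px N p) (px g p) := second (hgx p hp) hgxN _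
  have gxy : dot3 (py (px g) p) (N p) = -dot3 (py N p) (px g p) := second (hgx p hp) hgxN _
  have gyx : dot3 (px (py g) p) (N p) = -dot3 (px N p) (py g p) := second (hgy p hp) hgyN _
  have gyy : dot3 (py (py g) p) (N p) = -dot3 (py N p) (py g p) := second (hgy p hp) hgyN _
  have fxx : dot3 (px (px f) p) (N p) = -dot3 (px N p) (px f p) := second hfx hfxN _
  have fxy : dot3 (py (px f) p) (N p) = -dot3 (py N p) (px f p) := second hfx hfxN _
  have fyx : dot3 (px (py f) p) (N p) = -dot3 (px N p) (py f p) := second hfy hfyN _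
  have fyy : dot3 (py (py f) p) (N p) = -dot3 (py N p) (py f p) := second hfy hfyN _
  have gcomm : py (px g) p = px (py g) p := fderiv_fderiv_comm (hgs p hp) _ _
  have fcomm : py (px f) p = px (py f) p := fderiv_fderiv_comm (hfs p hp) _ _
  have hpos := dot3_self_pos (himm p hp)
  have hperp : ∀ e, dot3 (fderiv ℝ N p e) (cross3 (px g p) (py g p)) = 0 := by
    intro e
    have h := hdN p hp e
    rw [congrArg (dot3 (fderiv ℝ N p e)) (hN p hp), dot3_smul_right] at h
    exact (mul_eq_zero.1 h).resolve_left (inv_ne_zero (Real.sqrt_pos.2 hpos).ne')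
  have hsymm : dot3 (py N p) (px g p) = dot3 (px N p) (py g p) := by
    rw [gcomm] at gxy; linarith
  have hfsymm : dot3 (py N p) (px f p) = dot3 (px N p) (py f p) := by
    rw [fcomm] at fxy; linarith
  have hm := hmean p hp
  rw [MeanH, gxx, gxy, gyy] at hm
  have hk : GaussK g N p = GaussK g N p := rfl
  nth_rewrite 1 [GaussK] at hk
  rw [gxx, gxy, gyy] at hk
  obtain ⟨hc, hcf⟩ := parallel_surface_algebra (u := px N p) (v := py N p) hH₁
    (himm p hp) (hperp _) (hperp _) hsymm hm hk
  have hpx : px f p = px g p + (1 / (2 * H₁)) • px N p := hfd p hp _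
  have hpy : py f p = py g p + (1 / (2 * H₁)) • py N p := hfd p hp _
  rw [← hpx, ← hpy] at hcf
  have hnum : -dot3 (px N p) (px f p) * -dot3 (py N p) (py f p) - (-dot3 (py N p) (px f p)) ^ 2 =
      dot3 (cross3 (px N p) (py N p)) (cross3 (px f p) (py f p)) := by
    rw [dot3_cross3_cross3, ← hfsymm]; ring
  have hden : dot3 (px f p) (px f p) * dot3 (py f p) (py f p) - dot3 (px f p) (py f p) ^ 2 =
      dot3 (cross3 (px f p) (py f p)) (cross3 (px f p) (py f p)) := by
    rw [dot3_cross3_cross3, dot3_comm (py f p) (px f p)]; ring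
  refine ⟨?_, ⟨?_, hfxN p hp, hfyN p hp⟩, ?_⟩
  · rw [hcf]
    exact smul_ne_zero (mul_ne_zero (by positivity) hK) (himm p hp)
  · rw [norm3, hNN p hp, Real.sqrt_one]
  · rw [GaussK, fxx, fxy, fyy, hnum, hden, hc, hcf, dot3_smul_right, dot3_smul_right,
      dot3_comm (_ • _), dot3_comm (_ • _), dot3_smul_right, dot3_smul_right]
    have := hpos.ne'
    field_simp
    norm_num
end
end

section
/- Let Ω ⊆ ℝ² be open, let N : Ω → ℝ³ be smooth with ‖N(p)‖ = 1 for all p, and let f : Ω → ℝ³ be smooth with f_x = N × N_y and f_y = −N × N_x on Ω. Then ⟨f_x, N⟩ = ⟨f_y, N⟩ = 0 on Ω (so f is a frontal with normal N), and for every p ∈ Ω the rank of the total derivative of f at p equals the rank of the total derivative of N at p. In particular, f is an immersion at p if and only if N is an immersion at p. -/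
noncomputable section

open Real

lemma dot3_cross3_left (n v : Fin 3 → ℝ) : dot3 (cross3 n v) n = 0 := by
  simp only [dot3, cross3, Matrix.cons_val]
  ring

lemma cross3_cross3_of_unit {n v : Fin 3 → ℝ} (hn : dot3 n n = 1) (hv : dot3 v n = 0) :
    cross3 n (cross3 n v) = -v := by
  simp only [dot3] at hn hv
  ext i
  fin_cases i <;> simp only [cross3, Fin.zero_eta, Fin.mk_one, Fin.reduceFinMk, Pi.neg_apply,
    Matrix.cons_val]
  · linear_combination n 0 * hv - v 0 * hn
  · linear_combination n 1 * hv - v 1 * hn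
  · linear_combination n 2 * hv - v 2 * hn

/-- The cross product of two tangent vectors is unchanged by a quarter turn about the normal. -/
lemma cross3_rotate_of_unit {n a b : Fin 3 → ℝ} (hn : dot3 n n = 1) (ha : dot3 a n = 0)
    (hb : dot3 b n = 0) : cross3 (cross3 n b) (-(cross3 n a)) = cross3 a b := by
  simp only [dot3] at hn ha hb
  ext i
  fin_cases i <;> simp only [cross3, Fin.zero_eta, Fin.mk_one, Fin.reduceFinMk, Pi.neg_apply,
    Matrix.cons_val]
  · linear_combination (n 1 * a 2 - n 2 * a 1) * hb - (n 1 * b 2 - n 2 * b 1) * ha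
      + (a 1 * b 2 - a 2 * b 1) * hn
  · linear_combination (n 2 * a 0 - n 0 * a 2) * hb - (n 2 * b 0 - n 0 * b 2) * ha
      + (a 2 * b 0 - a 0 * b 2) * hn
  · linear_combination (n 0 * a 1 - n 1 * a 0) * hb - (n 0 * b 1 - n 1 * b 0) * ha
      + (a 0 * b 1 - a 1 * b 0) * hn

/-- The linear map `v ↦ n × v`. -/
def cross3Lin (n : Fin 3 → ℝ) : (Fin 3 → ℝ) →ₗ[ℝ] (Fin 3 → ℝ) where
  toFun := cross3 n
  map_add' u v := by
    ext i
    fin_cases i <;> simp [cross3] <;> ring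
  map_smul' c v := by
    ext i
    fin_cases i <;> simp [cross3] <;> ring

@[simp]
lemma cross3Lin_apply (n v : Fin 3 → ℝ) : cross3Lin n v = cross3 n v := rfl

/-- The quarter turn `(x, y) ↦ (-y, x)` of the plane. -/
def quarterTurn : (ℝ × ℝ) →ₗ[ℝ] (ℝ × ℝ) :=
  (-LinearMap.snd ℝ ℝ ℝ).prod (LinearMap.fst ℝ ℝ ℝ)

@[simp]
lemma quarterTurn_apply (v : ℝ × ℝ) : quarterTurn v = (-v.2, v.1) := rfl

lemma rank_comp_comp_le {V W : Type} [AddCommGroup V] [Module ℝ V] [AddCommGroup W] [Module ℝ W]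
    (C : W →ₗ[ℝ] W) (A : V →ₗ[ℝ] W) (J : V →ₗ[ℝ] V) :
    LinearMap.rank (C ∘ₗ A ∘ₗ J) ≤ LinearMap.rank A :=
  (LinearMap.rank_comp_le_right _ _).trans (LinearMap.rank_comp_le_left _ _)

lemma dot3_fderiv_of_unit {Ω : Set (ℝ × ℝ)} (hΩ : IsOpen Ω) {N : ℝ × ℝ → Fin 3 → ℝ}
    (hunit : ∀ p ∈ Ω, dot3 (N p) (N p) = 1) {p : ℝ × ℝ} (hp : p ∈ Ω)
    (hN : DifferentiableAt ℝ N p) (v : ℝ × ℝ) : dot3 (fderiv ℝ N p v) (N p) = 0 := by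
  have hc : ∀ i, HasFDerivAt (fun q => N q i)
      ((ContinuousLinearMap.proj i).comp (fderiv ℝ N p)) p :=
    fun i => hasFDerivAt_pi'.1 hN.hasFDerivAt i
  have hd := (((hc 0).mul (hc 0)).add ((hc 1).mul (hc 1))).add ((hc 2).mul (hc 2))
  have hconst : HasFDerivAt (fun q => dot3 (N q) (N q)) (0 : (ℝ × ℝ) →L[ℝ] ℝ) p :=
    (hasFDerivAt_const (1 : ℝ) p).congr_of_eventuallyEq
      (Filter.eventuallyEq_of_mem (hΩ.mem_nhds hp) hunit)
  have h := congrArg (fun L : (ℝ × ℝ) →L[ℝ] ℝ => L v) (hd.unique hconst)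
  simp at h
  simp only [dot3]
  linarith

/-- a spherical frontal `f` is orthogonal to `N`, and the rank of `df` equals
the rank of `dN` at every point; in particular `f` is an immersion at `p` iff `N` is. -/
theorem stmt4 (Ω : Set (ℝ × ℝ)) (hΩ : IsOpen Ω)
    (N f : ℝ × ℝ → Fin 3 → ℝ)
    (hN : ContDiffOn ℝ (⊤ : ℕ∞) N Ω) (hf : ContDiffOn ℝ (⊤ : ℕ∞) f Ω)
    (hunit : ∀ p ∈ Ω, norm3 (N p) = 1)
    (heq : ∀ p ∈ Ω, px f p = cross3 (N p) (py N p) ∧ py f p = -(cross3 (N p) (px N p))) :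
    ∀ p ∈ Ω,
      dot3 (px f p) (N p) = 0 ∧ dot3 (py f p) (N p) = 0 ∧
      LinearMap.rank (fderiv ℝ f p).toLinearMap = LinearMap.rank (fderiv ℝ N p).toLinearMap ∧
      (cross3 (px f p) (py f p) ≠ 0 ↔ cross3 (px N p) (py N p) ≠ 0) := by
  intro p hp
  have hn : ∀ q ∈ Ω, dot3 (N q) (N q) = 1 := fun q hq => Real.sqrt_eq_one.1 (hunit q hq)
  have hNp : DifferentiableAt ℝ N p :=
    (hN.contDiffAt (hΩ.mem_nhds hp)).differentiableAt (by simp)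
  have horth := dot3_fderiv_of_unit hΩ hn hp hNp
  obtain ⟨hx, hy⟩ := heq p hp
  have hfN : (fderiv ℝ f p).toLinearMap =
      cross3Lin (N p) ∘ₗ (fderiv ℝ N p).toLinearMap ∘ₗ quarterTurn := by
    ext1 <;> ext1
    · simpa [px, py] using hx
    · have hturn : quarterTurn (0, 1) = -(1, 0) := by simp
      change py f p = cross3Lin (N p) (fderiv ℝ N p (quarterTurn (0, 1)))
      rw [hturn, map_neg, map_neg, hy]
      rfl
  have hNf : (fderiv ℝ N p).toLinearMap =
      cross3Lin (N p) ∘ₗ (fderiv ℝ f p).toLinearMap ∘ₗ quarterTurn := by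
    refine LinearMap.ext fun v => ?_
    have hturn : quarterTurn (quarterTurn v) = -v := by simp [Prod.ext_iff]
    rw [hfN]
    simp only [LinearMap.comp_apply, hturn, map_neg, cross3Lin_apply,
      ContinuousLinearMap.coe_coe]
    rw [cross3_cross3_of_unit (hn p hp) (horth v), neg_neg]
  refine ⟨hx ▸ dot3_cross3_left _ _, ?_, le_antisymm ?_ ?_, ?_⟩
  · have h := dot3_cross3_left (N p) (px N p)
    rw [hy]
    simp only [dot3, Pi.neg_apply] at h ⊢
    linarith
  · rw [hfN]
    exact rank_comp_comp_le _ _ _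
  · rw [hNf]
    exact rank_comp_comp_le _ _ _
  · have h : cross3 (cross3 (N p) (py N p)) (-(cross3 (N p) (px N p))) =
        cross3 (px N p) (py N p) :=
      cross3_rotate_of_unit (hn p hp) (horth (1, 0)) (horth (0, 1))
    rw [hx, hy, h]
end
end
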